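/- arXiv:1207.0797 — 2 statements merged into one kernel-verified Lean document; each statement's English description precedes it below -/
import Mathlib

section
/- Let Z ~ SN_d(ξ, Ω, α) with covariance matrix Σ = Ω − (2/π) ωδδᵀω, where δ = Ω̄α / (1 + αᵀΩ̄α)^{1/2}, and set δ* = (δᵀ Ω̄⁻¹ δ)^{1/2}. If α ≠ 0, then the eigenvalues of the matrix Ω⁻¹Σ are 1 with multiplicity d − 1 and 1 − (2/π)δ*² with multiplicity 1; the eigenspace associated with the eigenvalue 1 − (2/π)δ*² is the line spanned by ω⁻¹α, and the eigenspace associated with the eigenvalue 1 is the orthogonal complement of the line spanned by ωδ. -/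
open MeasureTheory ProbabilityTheory Matrix

noncomputable section

/-- Standard normal density. -/
def stdNormalPDF (x : ℝ) : ℝ := (Real.sqrt (2 * Real.pi))⁻¹ * Real.exp (-x ^ 2 / 2)

/-- Standard normal cumulative distribution function `Φ`. -/
def stdNormalCDF (x : ℝ) : ℝ := ∫ t in Set.Iic x, stdNormalPDF t

/-- Density `φ_d(x; Ω)` of the centered multivariate normal `N_d(0, Ω)`. -/
def mvnPDF {d : ℕ} (Ωm : Matrix (Fin d) (Fin d) ℝ) (x : Fin d → ℝ) : ℝ :=
  (2 * Real.pi) ^ (-(d : ℝ) / 2) * Ωm.det ^ (-(1 : ℝ) / 2) *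
    Real.exp (-(x ⬝ᵥ (Ωm⁻¹ *ᵥ x)) / 2)

/-- The diagonal matrix `ω` of scale parameters, `ω_ii = √(Ω_ii)`. -/
def scaleMat {d : ℕ} (Ωm : Matrix (Fin d) (Fin d) ℝ) : Matrix (Fin d) (Fin d) ℝ :=
  Matrix.diagonal fun i => Real.sqrt (Ωm i i)

/-- The correlation matrix `Ω̄ = ω⁻¹ Ω ω⁻¹`. -/
def corrMat {d : ℕ} (Ωm : Matrix (Fin d) (Fin d) ℝ) : Matrix (Fin d) (Fin d) ℝ :=
  (scaleMat Ωm)⁻¹ * Ωm * (scaleMat Ωm)⁻¹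

/-- Density of the multivariate skew-normal distribution `SN_d(ξ, Ω, α)`. -/
def snPDF {d : ℕ} (ξ : Fin d → ℝ) (Ωm : Matrix (Fin d) (Fin d) ℝ) (α : Fin d → ℝ)
    (z : Fin d → ℝ) : ℝ :=
  2 * mvnPDF Ωm (z - ξ) * stdNormalCDF (α ⬝ᵥ ((scaleMat Ωm)⁻¹ *ᵥ (z - ξ)))

/-- `Z ~ SN_d(ξ, Ω, α)`. -/
def IsSN {Ω' : Type*} [MeasurableSpace Ω'] (P : Measure Ω') {d : ℕ}
    (Z : Ω' → Fin d → ℝ) (ξ : Fin d → ℝ) (Ωm : Matrix (Fin d) (Fin d) ℝ)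
    (α : Fin d → ℝ) : Prop :=
  Measure.map Z P = volume.withDensity fun z => ENNReal.ofReal (snPDF ξ Ωm α z)

/-- Density of the univariate skew-normal distribution `SN₁(0,1,α)`. -/
def sn1PDF (α x : ℝ) : ℝ := 2 * stdNormalPDF x * stdNormalCDF (α * x)

/-- The vector `δ = Ω̄α / (1 + αᵀΩ̄α)^{1/2}`. -/
def deltaOf {d : ℕ} (Ωb : Matrix (Fin d) (Fin d) ℝ) (α : Fin d → ℝ) : Fin d → ℝ :=
  (Real.sqrt (1 + α ⬝ᵥ (Ωb *ᵥ α)))⁻¹ • (Ωb *ᵥ α)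


section RankOneUpdate

variable {K n : Type*} [Field K] [Fintype n] {T : Module.End K (n → K)} {u w : n → K} {k : K}

/-- A rank one update `v ↦ v - k (u ⬝ᵥ v) w` of the identity fixes exactly the vectors
orthogonal to `u`. -/
theorem mem_eigenspace_one_of_rankOneUpdate (hT : ∀ v, T v = v - (k * (u ⬝ᵥ v)) • w)
    (hk : k ≠ 0) (hw : w ≠ 0) (v : n → K) :
    v ∈ Module.End.eigenspace T 1 ↔ u ⬝ᵥ v = 0 := by
  rw [Module.End.mem_eigenspace_iff, hT, one_smul, sub_eq_self, smul_eq_zero]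
  simp [hk, hw]

theorem eigenspace_of_rankOneUpdate (hT : ∀ v, T v = v - (k * (u ⬝ᵥ v)) • w)
    (hk : k ≠ 0) (huw : u ⬝ᵥ w ≠ 0) :
    Module.End.eigenspace T (1 - k * (u ⬝ᵥ w)) = Submodule.span K {w} := by
  ext v
  rw [Module.End.mem_eigenspace_iff, hT, Submodule.mem_span_singleton, sub_smul, one_smul,
    sub_right_inj]
  constructor
  · intro h
    refine ⟨(k * (u ⬝ᵥ w))⁻¹ * (k * (u ⬝ᵥ v)), ?_⟩
    rw [mul_smul, h, smul_smul, inv_mul_cancel₀ (mul_ne_zero hk huw), one_smul]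
  · rintro ⟨c, rfl⟩
    rw [dotProduct_smul, smul_smul, smul_eq_mul]
    congr 1
    ring

theorem finrank_eigenspace_one_of_rankOneUpdate (hT : ∀ v, T v = v - (k * (u ⬝ᵥ v)) • w)
    (hk : k ≠ 0) (hu : u ≠ 0) (hw : w ≠ 0) :
    Module.finrank K (Module.End.eigenspace T 1) = Fintype.card n - 1 := by
  classical
  have hker : Module.End.eigenspace T 1 = LinearMap.ker (dotProductBilin K K u) := by
    ext v
    rw [mem_eigenspace_one_of_rankOneUpdate hT hk hw, LinearMap.mem_ker]
    rfl
  have hne : (dotProductBilin K K u : (n → K) →ₗ[K] K) ≠ 0 := fun h =>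
    hu <| dotProduct_eq_zero u fun v => LinearMap.congr_fun h v
  have := Module.Dual.finrank_ker_add_one_of_ne_zero hne
  rw [Module.finrank_fintype_fun_eq_card] at this
  rw [hker]
  omega

end RankOneUpdate

theorem isUnit_det_scaleMat {d : ℕ} {Ωm : Matrix (Fin d) (Fin d) ℝ} (hΩ : Ωm.PosDef) :
    IsUnit (scaleMat Ωm).det := by
  rw [scaleMat, det_diagonal, isUnit_iff_ne_zero]
  exact Finset.prod_ne_zero_iff.2 fun i _ => (Real.sqrt_pos.2 hΩ.diag_pos).ne'

theorem corrMat_mulVec {d : ℕ} (Ωm : Matrix (Fin d) (Fin d) ℝ) (α : Fin d → ℝ) :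
    corrMat Ωm *ᵥ α = (scaleMat Ωm)⁻¹ *ᵥ (Ωm *ᵥ ((scaleMat Ωm)⁻¹ *ᵥ α)) := by
  simp only [corrMat, mulVec_mulVec, mul_assoc]

theorem dotProduct_corrMat_mulVec {d : ℕ} (Ωm : Matrix (Fin d) (Fin d) ℝ) (α : Fin d → ℝ) :
    α ⬝ᵥ (corrMat Ωm *ᵥ α) =
      ((scaleMat Ωm)⁻¹ *ᵥ α) ⬝ᵥ (Ωm *ᵥ ((scaleMat Ωm)⁻¹ *ᵥ α)) := by
  rw [corrMat_mulVec, dotProduct_mulVec, ← mulVec_transpose, transpose_nonsing_inv, scaleMat,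
    diagonal_transpose]

theorem scaleMat_mulVec_deltaOf {d : ℕ} {Ωm : Matrix (Fin d) (Fin d) ℝ} (hΩ : Ωm.PosDef)
    (α : Fin d → ℝ) :
    scaleMat Ωm *ᵥ deltaOf (corrMat Ωm) α =
      (Real.sqrt (1 + α ⬝ᵥ (corrMat Ωm *ᵥ α)))⁻¹ • (Ωm *ᵥ ((scaleMat Ωm)⁻¹ *ᵥ α)) := by
  rw [deltaOf, mulVec_smul, corrMat_mulVec, mulVec_mulVec (Ωm *ᵥ _) (scaleMat Ωm),
    mul_nonsing_inv _ (isUnit_det_scaleMat hΩ), one_mulVec]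

theorem isUnit_det_corrMat {d : ℕ} {Ωm : Matrix (Fin d) (Fin d) ℝ} (hΩ : Ωm.PosDef) :
    IsUnit (corrMat Ωm).det := by
  have hω := isUnit_nonsing_inv_det _ (isUnit_det_scaleMat hΩ)
  rw [corrMat, det_mul, det_mul]
  exact (hω.mul hΩ.det_pos.ne'.isUnit).mul hω

theorem deltaOf_dotProduct_inv_mulVec {d : ℕ} {Ωb : Matrix (Fin d) (Fin d) ℝ}
    (hΩb : IsUnit Ωb.det) (α : Fin d → ℝ) :
    deltaOf Ωb α ⬝ᵥ (Ωb⁻¹ *ᵥ deltaOf Ωb α) =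
      (Real.sqrt (1 + α ⬝ᵥ (Ωb *ᵥ α)))⁻¹ ^ 2 * (α ⬝ᵥ (Ωb *ᵥ α)) := by
  rw [deltaOf, mulVec_smul, mulVec_mulVec, nonsing_inv_mul _ hΩb, one_mulVec, smul_dotProduct,
    dotProduct_smul, dotProduct_comm (Ωb *ᵥ α), smul_eq_mul, smul_eq_mul, sq, mul_assoc]

/-- eigenvalues and eigenspaces of `Ω⁻¹Σ` for a skew-normal variate. -/
theorem eigen_structure_skew_normal
    {d : ℕ} (α : Fin d → ℝ) (Ωm : Matrix (Fin d) (Fin d) ℝ)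
    (hΩ : Ωm.PosDef) (hα : α ≠ 0) :
    let ω := scaleMat Ωm
    let δ := deltaOf (corrMat Ωm) α
    let δstar := Real.sqrt (δ ⬝ᵥ ((corrMat Ωm)⁻¹ *ᵥ δ))
    let Sig := Ωm - (2 / Real.pi) • Matrix.vecMulVec (ω *ᵥ δ) (ω *ᵥ δ)
    let T := Matrix.toLin' (Ωm⁻¹ * Sig)
    -- the eigenspace of the eigenvalue 1 is the orthogonal complement of the span of ωδ
    (∀ v : Fin d → ℝ, v ∈ Module.End.eigenspace T 1 ↔ (ω *ᵥ δ) ⬝ᵥ v = 0) ∧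
    -- the eigenspace of the eigenvalue 1 − (2/π)δ*² is the line spanned by ω⁻¹α
    (∀ v : Fin d → ℝ,
      v ∈ Module.End.eigenspace T (1 - (2 / Real.pi) * δstar ^ 2) ↔
        ∃ c : ℝ, v = c • (ω⁻¹ *ᵥ α)) ∧
    -- multiplicities: 1 has multiplicity d − 1 ...
    Module.finrank ℝ (Module.End.eigenspace T 1) = d - 1 ∧
    -- ... and 1 − (2/π)δ*² has multiplicity 1
    Module.finrank ℝ (Module.End.eigenspace T (1 - (2 / Real.pi) * δstar ^ 2)) = 1 := by
  intro ω δ δstar Sig T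
  have hω : IsUnit ω.det := isUnit_det_scaleMat hΩ
  have hΩu : IsUnit Ωm.det := hΩ.det_pos.ne'.isUnit
  set w := ω⁻¹ *ᵥ α with hw_def
  set q := α ⬝ᵥ (corrMat Ωm *ᵥ α) with hq_def
  set s := (Real.sqrt (1 + q))⁻¹ with hs_def
  have hw : w ≠ 0 := by
    intro h
    apply hα
    rw [← one_mulVec α, ← mul_nonsing_inv _ hω, ← mulVec_mulVec, ← hw_def, h, mulVec_zero]
  have hqw : q = w ⬝ᵥ (Ωm *ᵥ w) := dotProduct_corrMat_mulVec Ωm α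
  have hq : 0 < q := by
    rw [hqw]
    simpa using hΩ.dotProduct_mulVec_pos hw
  have hs : 0 < s := inv_pos.2 (Real.sqrt_pos.2 (by linarith))
  have hu : ω *ᵥ δ = s • (Ωm *ᵥ w) := scaleMat_mulVec_deltaOf hΩ α
  have huw : (ω *ᵥ δ) ⬝ᵥ w = s * q := by
    rw [hu, smul_dotProduct, dotProduct_comm, hqw, smul_eq_mul]
  have huw0 : (ω *ᵥ δ) ⬝ᵥ w ≠ 0 := huw ▸ (mul_pos hs hq).ne'
  have hu0 : ω *ᵥ δ ≠ 0 := fun h => huw0 (by rw [h, zero_dotProduct])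
  have hk : 2 / Real.pi * s ≠ 0 := by positivity
  have hT : ∀ v, T v = v - (2 / Real.pi * s * ((ω *ᵥ δ) ⬝ᵥ v)) • w := by
    intro v
    have hinv : Ωm⁻¹ *ᵥ (ω *ᵥ δ) = s • w := by
      rw [hu, mulVec_smul, mulVec_mulVec, nonsing_inv_mul _ hΩu, one_mulVec]
    rw [toLin'_apply, mul_sub, nonsing_inv_mul _ hΩu, sub_mulVec, one_mulVec, mul_smul_comm,
      mul_vecMulVec, hinv, smul_mulVec, vecMulVec_mulVec, op_smul_eq_smul, smul_smul, smul_smul]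
    congr 2
    ring
  have hstar : 2 / Real.pi * δstar ^ 2 = 2 / Real.pi * s * ((ω *ᵥ δ) ⬝ᵥ w) := by
    have hδ : δ ⬝ᵥ ((corrMat Ωm)⁻¹ *ᵥ δ) = s ^ 2 * q :=
      deltaOf_dotProduct_inv_mulVec (isUnit_det_corrMat hΩ) α
    rw [Real.sq_sqrt (by rw [hδ]; positivity), hδ, huw]
    ring
  rw [hstar]
  refine ⟨mem_eigenspace_one_of_rankOneUpdate hT hk hw, fun v => ?_, ?_, ?_⟩
  · rw [eigenspace_of_rankOneUpdate hT hk huw0, Submodule.mem_span_singleton]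
    simp only [eq_comm]
  · simpa using finrank_eigenspace_one_of_rankOneUpdate hT hk hu0 hw
  · rw [eigenspace_of_rankOneUpdate hT hk huw0, finrank_span_singleton hw]

end
end

section
/- Let Y = ξ + ω S Z, where Z ~ SN_d(0, Ω̄, α) and S > 0 is a scalar random variable independent of Z with E(S³) < ∞. Set δ = Ω̄α/(1 + αᵀΩ̄α)^{1/2}, δ* = (δᵀΩ̄⁻¹δ)^{1/2}, σ*² = E(S²) − (2/π)E(S)²δ*², and let γ₁* denote the Pearson skewness index of the scalar variable Y₁* = S W with W ~ SN₁(0,1,α*) independent of S, α* = (αᵀΩ̄α)^{1/2}. Then the Mardia multivariate skewness index of Y is γ_{1,d} = (γ₁*)² + [3(d−1)/(σ*² E(S²)²)] [E(S³) − E(S)E(S²)]² (2/π) δ*². -/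
open MeasureTheory ProbabilityTheory Matrix

noncomputable section

theorem stdNormalPDF_eq_gaussianPDFReal : stdNormalPDF = gaussianPDFReal 0 1 := by
  ext x; simp [stdNormalPDF, gaussianPDFReal]

theorem stdNormalPDF_pos (x : ℝ) : 0 < stdNormalPDF x := by
  unfold stdNormalPDF; positivity

theorem stdNormalPDF_neg (x : ℝ) : stdNormalPDF (-x) = stdNormalPDF x := by
  simp [stdNormalPDF]

theorem continuous_stdNormalPDF : Continuous stdNormalPDF := by
  unfold stdNormalPDF; fun_prop

theorem integrable_stdNormalPDF : Integrable stdNormalPDF := by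
  rw [stdNormalPDF_eq_gaussianPDFReal]; exact integrable_gaussianPDFReal 0 1

theorem integral_stdNormalPDF : ∫ x, stdNormalPDF x = 1 := by
  rw [stdNormalPDF_eq_gaussianPDFReal]
  exact integral_gaussianPDFReal_eq_one 0 one_ne_zero

theorem gaussianReal_eq_withDensity_stdNormalPDF :
    gaussianReal 0 1 = volume.withDensity fun x => ENNReal.ofReal (stdNormalPDF x) := by
  rw [stdNormalPDF_eq_gaussianPDFReal, gaussianReal_of_var_ne_zero 0 one_ne_zero]
  rfl

theorem integrable_pow_mul_stdNormalPDF (n : ℕ) : Integrable fun x => x ^ n * stdNormalPDF x := by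
  have h := integrable_rpow_mul_exp_neg_mul_sq (b := 1 / 2) (by norm_num) (s := n)
    (by linarith [n.cast_nonneg (α := ℝ)])
  refine (h.const_mul (Real.sqrt (2 * Real.pi))⁻¹).congr (ae_of_all _ fun x => ?_)
  simp only [stdNormalPDF, Real.rpow_natCast]
  rw [show -(1 / 2 : ℝ) * x ^ 2 = -x ^ 2 / 2 by ring]
  ring

theorem hasDerivAt_stdNormalPDF (x : ℝ) :
    HasDerivAt stdNormalPDF (-(x * stdNormalPDF x)) x := by
  have h : HasDerivAt (fun y : ℝ => -y ^ 2 / 2) (-x) x := by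
    convert! ((hasDerivAt_pow 2 x).neg.div_const 2) using 1
    norm_num
    ring
  convert! (h.exp.const_mul (Real.sqrt (2 * Real.pi))⁻¹) using 1
  simp only [stdNormalPDF]
  ring

theorem stdNormalCDF_nonneg (x : ℝ) : 0 ≤ stdNormalCDF x :=
  integral_nonneg fun t => (stdNormalPDF_pos t).le

theorem stdNormalCDF_le_one (x : ℝ) : stdNormalCDF x ≤ 1 := by
  rw [← integral_stdNormalPDF]
  exact setIntegral_le_integral integrable_stdNormalPDF (ae_of_all _ fun t => (stdNormalPDF_pos t).le)

theorem stdNormalCDF_add_neg (x : ℝ) : stdNormalCDF x + stdNormalCDF (-x) = 1 := by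
  have h : stdNormalCDF (-x) = ∫ t in Set.Ioi x, stdNormalPDF t := by
    unfold stdNormalCDF
    rw [← integral_comp_neg_Ioi]
    simp [stdNormalPDF_neg]
  rw [h, stdNormalCDF, ← integral_stdNormalPDF, ← Set.compl_Iic]
  exact integral_add_compl measurableSet_Iic integrable_stdNormalPDF

theorem hasDerivAt_stdNormalCDF (x : ℝ) : HasDerivAt stdNormalCDF (stdNormalPDF x) x := by
  have h : stdNormalCDF = fun y => stdNormalCDF 0 + ∫ t in (0 : ℝ)..y, stdNormalPDF t := by
    ext y
    rw [← intervalIntegral.integral_Iic_sub_Iic integrable_stdNormalPDF.integrableOn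
      integrable_stdNormalPDF.integrableOn]
    simp [stdNormalCDF]
  rw [h]
  exact (continuous_stdNormalPDF.integral_hasStrictDerivAt 0 x).hasDerivAt.const_add _

theorem continuous_stdNormalCDF : Continuous stdNormalCDF :=
  continuous_iff_continuousAt.2 fun x => (hasDerivAt_stdNormalCDF x).continuousAt

theorem sn1PDF_nonneg (a x : ℝ) : 0 ≤ sn1PDF a x := by
  have := stdNormalPDF_pos x
  have := stdNormalCDF_nonneg (a * x)
  unfold sn1PDF; positivity

theorem continuous_sn1PDF (a : ℝ) : Continuous (sn1PDF a) :=
  (continuous_stdNormalPDF.const_mul 2).mul (continuous_stdNormalCDF.comp (continuous_const_mul a))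

theorem integrable_pow_mul_sn1PDF (a : ℝ) (n : ℕ) : Integrable fun x => x ^ n * sn1PDF a x := by
  refine ((integrable_pow_mul_stdNormalPDF n).const_mul 2).mono
    ((continuous_pow n).mul (continuous_sn1PDF a)).aestronglyMeasurable (ae_of_all _ fun x => ?_)
  have h0 := stdNormalCDF_nonneg (a * x)
  have h1 := stdNormalCDF_le_one (a * x)
  simp only [sn1PDF, norm_mul, Real.norm_eq_abs, abs_of_nonneg h0]
  have : 0 ≤ |x ^ n| * (|(2 : ℝ)| * |stdNormalPDF x|) := by positivity
  nlinarith

theorem integrable_sn1PDF (a : ℝ) : Integrable (sn1PDF a) := by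
  simpa using integrable_pow_mul_sn1PDF a 0

/-- Even moments do not see the skewing factor of the skew-normal density. -/
theorem integral_mul_sn1PDF_of_even (a : ℝ) {n : ℕ} (hn : Even n) :
    ∫ x, x ^ n * sn1PDF a x = ∫ x, x ^ n * stdNormalPDF x := by
  have h1 : ∫ x, x ^ n * sn1PDF a x = ∫ x, x ^ n * sn1PDF a (-x) := by
    rw [← integral_neg_eq_self]
    simp [hn.neg_pow]
  have h2 : Integrable fun x => x ^ n * sn1PDF a (-x) := by
    simpa [hn.neg_pow] using (integrable_pow_mul_sn1PDF a n).comp_neg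
  have h3 : ∫ x, (x ^ n * sn1PDF a x + x ^ n * sn1PDF a (-x)) = 2 * ∫ x, x ^ n * stdNormalPDF x := by
    rw [← integral_const_mul]
    congr 1 with x
    simp only [sn1PDF, stdNormalPDF_neg, mul_neg]
    linear_combination 2 * x ^ n * stdNormalPDF x * stdNormalCDF_add_neg (a * x)
  rw [integral_add (integrable_pow_mul_sn1PDF a n) h2, ← h1] at h3
  linarith

theorem integral_pow_mul_stdNormalPDF_of_odd {n : ℕ} (hn : Odd n) :
    ∫ x, x ^ n * stdNormalPDF x = 0 := by
  have h : ∫ x, x ^ n * stdNormalPDF x = -∫ x, x ^ n * stdNormalPDF x := by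
    nth_rw 1 [← integral_neg_eq_self]
    simp [hn.neg_pow, stdNormalPDF_neg, integral_neg]
  linarith

theorem integral_sq_mul_stdNormalPDF : ∫ x, x ^ 2 * stdNormalPDF x = 1 := by
  have h := integral_mul_deriv_eq_deriv_mul_of_integrable (u := fun x : ℝ => x)
    (v := stdNormalPDF) (u' := fun _ => 1) (v' := fun x => -(x * stdNormalPDF x))
    (fun x _ => hasDerivAt_id x) (fun x _ => hasDerivAt_stdNormalPDF x)
    ((integrable_pow_mul_stdNormalPDF 2).neg.congr (ae_of_all _ fun x => by
      simp only [Pi.neg_apply, Pi.mul_apply]; ring))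
    (by simpa [Pi.mul_def] using integrable_stdNormalPDF)
    (by simpa [Pi.mul_def] using integrable_pow_mul_stdNormalPDF 1)
  simp only [mul_neg, integral_neg, one_mul, integral_stdNormalPDF] at h
  have h' : ∫ x : ℝ, x ^ 2 * stdNormalPDF x = ∫ x, x * (x * stdNormalPDF x) := by
    congr 1 with x; ring
  linarith

theorem integral_mul_sn1PDF (a : ℝ) :
    ∫ x, x * sn1PDF a x = Real.sqrt (2 / Real.pi) * (a / Real.sqrt (1 + a ^ 2)) := by
  have hcdf : ∀ x, HasDerivAt (fun y => stdNormalCDF (a * y)) (stdNormalPDF (a * x) * a) x :=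
    fun x => (hasDerivAt_stdNormalCDF (a * x)).comp x (by simpa using (hasDerivAt_id x).const_mul a)
  have hexp : ∀ x, stdNormalPDF (a * x) * a * stdNormalPDF x
      = a / (2 * Real.pi) * Real.exp (-((1 + a ^ 2) / 2) * x ^ 2) := fun x => by
    have h2 : Real.exp (-((1 + a ^ 2) / 2) * x ^ 2)
        = Real.exp (-(a * x) ^ 2 / 2) * Real.exp (-x ^ 2 / 2) := by
      rw [← Real.exp_add]; congr 1; ring
    have h3 : (Real.sqrt (2 * Real.pi))⁻¹ * (Real.sqrt (2 * Real.pi))⁻¹ = (2 * Real.pi)⁻¹ := by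
      rw [← mul_inv, Real.mul_self_sqrt (by positivity)]
    simp only [stdNormalPDF]
    rw [h2, div_eq_mul_inv a, ← h3]
    ring
  have hInt : Integrable fun x => stdNormalPDF (a * x) * a * stdNormalPDF x := by
    simp only [hexp]
    exact (integrable_exp_neg_mul_sq (by positivity)).const_mul _
  have h := integral_mul_deriv_eq_deriv_mul_of_integrable
    (u := fun x : ℝ => stdNormalCDF (a * x)) (v := stdNormalPDF)
    (u' := fun x => stdNormalPDF (a * x) * a) (v' := fun x => -(x * stdNormalPDF x))
    (fun x _ => hcdf x) (fun x _ => hasDerivAt_stdNormalPDF x)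
    (((integrable_pow_mul_sn1PDF a 1).const_mul (-1 / 2)).congr (ae_of_all _ fun x => by
      simp only [Pi.mul_apply, sn1PDF]; ring))
    hInt
    (((integrable_sn1PDF a).const_mul (1 / 2)).congr (ae_of_all _ fun x => by
      simp only [Pi.mul_apply, sn1PDF]; ring))
  simp only [hexp, integral_const_mul, integral_gaussian] at h
  have h' : ∫ x : ℝ, x * sn1PDF a x
      = -2 * ∫ x, stdNormalCDF (a * x) * -(x * stdNormalPDF x) := by
    rw [← integral_const_mul]
    congr 1 with x; simp only [sn1PDF]; ring
  rw [h', h]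
  have hpi := Real.pi_pos
  have hs : Real.pi / ((1 + a ^ 2) / 2) = (2 / Real.pi) * (Real.pi ^ 2 / (1 + a ^ 2)) := by
    field_simp
  rw [hs, Real.sqrt_mul (by positivity), Real.sqrt_div (sq_nonneg _), Real.sqrt_sq hpi.le]
  have : Real.sqrt (1 + a ^ 2) ≠ 0 := (Real.sqrt_pos.2 (by positivity)).ne'
  field_simp

/-- The law `SN₁(0, 1, a)`. -/
def sn1Law (a : ℝ) : Measure ℝ := volume.withDensity fun x => ENNReal.ofReal (sn1PDF a x)

theorem integral_sn1Law (a : ℝ) (f : ℝ → ℝ) :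
    ∫ x, f x ∂sn1Law a = ∫ x, f x * sn1PDF a x := by
  rw [sn1Law, integral_withDensity_eq_integral_toReal_smul
    (continuous_sn1PDF a).measurable.ennreal_ofReal (ae_of_all _ fun _ => ENNReal.ofReal_lt_top)]
  simp [ENNReal.toReal_ofReal (sn1PDF_nonneg a _), mul_comm]

instance isProbabilityMeasure_sn1Law (a : ℝ) : IsProbabilityMeasure (sn1Law a) := by
  refine ⟨?_⟩
  rw [sn1Law, withDensity_apply _ MeasurableSet.univ, Measure.restrict_univ,
    ← ofReal_integral_eq_lintegral_ofReal (integrable_sn1PDF a) (ae_of_all _ (sn1PDF_nonneg a))]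
  have h := integral_mul_sn1PDF_of_even a (n := 0) (by simp)
  simp only [pow_zero, one_mul, integral_stdNormalPDF] at h
  simp [h]

theorem memLp_three_sn1Law (a : ℝ) : MemLp (fun x => x) 3 (sn1Law a) := by
  refine (integrable_norm_rpow_iff aestronglyMeasurable_id (by simp) (by simp)).1 ?_
  rw [sn1Law, integrable_withDensity_iff (continuous_sn1PDF a).measurable.ennreal_ofReal
    (ae_of_all _ fun _ => ENNReal.ofReal_lt_top)]
  refine (integrable_pow_mul_sn1PDF a 3).norm.congr (ae_of_all _ fun x => ?_)
  simp only [ENNReal.toReal_ofReal (sn1PDF_nonneg a _), norm_mul, norm_pow,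
    Real.norm_of_nonneg (sn1PDF_nonneg a _)]
  norm_num

theorem pi_withDensity_ofReal {ι : Type*} [Fintype ι] {ρ : ι → ℝ → ℝ}
    (hρ : ∀ i x, 0 ≤ ρ i x) (hInt : ∀ i, Integrable (ρ i)) :
    (Measure.pi fun i => volume.withDensity fun x => ENNReal.ofReal (ρ i x))
      = volume.withDensity fun x : ι → ℝ => ENNReal.ofReal (∏ i, ρ i (x i)) := by
  have hfin : ∀ i, IsFiniteMeasure (volume.withDensity fun x => ENNReal.ofReal (ρ i x)) := fun i =>
    isFiniteMeasure_withDensity_ofReal (hInt i).2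
  refine Measure.pi_eq fun s hs => ?_
  have hnn : ∀ x : ι → ℝ, 0 ≤ ∏ i, ρ i (x i) := fun x => Finset.prod_nonneg fun i _ => hρ i _
  rw [withDensity_apply _ (MeasurableSet.univ_pi hs), volume_pi, Measure.restrict_pi_pi,
    ← ofReal_integral_eq_lintegral_ofReal (Integrable.fintype_prod fun i => (hInt i).restrict)
      (ae_of_all _ hnn), integral_fintype_prod_eq_prod, ENNReal.ofReal_prod_of_nonneg
      fun i _ => integral_nonneg (hρ i)]
  refine Finset.prod_congr rfl fun i _ => ?_
  rw [withDensity_apply _ (hs i), ofReal_integral_eq_lintegral_ofReal (hInt i).restrict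
    (ae_of_all _ (hρ i))]

theorem map_mulVec_withDensity {ι : Type*} [Fintype ι] [DecidableEq ι] {M : Matrix ι ι ℝ}
    (hM : M.det ≠ 0) {f : (ι → ℝ) → ENNReal} (hf : Measurable f) :
    Measure.map (fun x => M *ᵥ x)
        (volume.withDensity fun x => ENNReal.ofReal |M.det| * f (M *ᵥ x))
      = volume.withDensity f := by
  have hmeas : Measurable fun x : ι → ℝ => M *ᵥ x :=
    (Continuous.matrix_mulVec continuous_const continuous_id).measurable
  have hmap : Measure.map (fun x => M *ᵥ x) (volume : Measure (ι → ℝ))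
      = ENNReal.ofReal |M.det⁻¹| • volume := by
    rw [← Real.map_matrix_volume_pi_eq_smul_volume_pi hM]; rfl
  ext s hs
  rw [Measure.map_apply hmeas hs, withDensity_apply _ (hmeas hs), withDensity_apply _ hs,
    lintegral_const_mul _ (by fun_prop), ← setLIntegral_map hs hf hmeas, hmap,
    Measure.restrict_smul, lintegral_smul_measure, smul_eq_mul, ← mul_assoc,
    ← ENNReal.ofReal_mul (abs_nonneg _), ← abs_mul, mul_inv_cancel₀ hM]
  simp

theorem householder_mul_self {ι : Type*} [Fintype ι] [DecidableEq ι] (u : ι → ℝ) :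
    (1 - (2 / (u ⬝ᵥ u)) • vecMulVec u u) * (1 - (2 / (u ⬝ᵥ u)) • vecMulVec u u) = 1 := by
  have h : vecMulVec u u * vecMulVec u u = (u ⬝ᵥ u) • vecMulVec u u := by
    rw [vecMulVec_mul_vecMulVec]
    ext i j
    simp [vecMulVec_apply, mul_left_comm]
  have h2 : 2 / (u ⬝ᵥ u) * (2 / (u ⬝ᵥ u) * (u ⬝ᵥ u)) = 2 * (2 / (u ⬝ᵥ u)) := by
    rcases eq_or_ne (u ⬝ᵥ u) 0 with h0 | h0
    · simp [h0]
    · field_simp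
  rw [sub_mul, mul_sub, Matrix.one_mul, Matrix.one_mul, mul_sub, Matrix.mul_one, smul_mul_smul_comm,
    h, smul_smul, mul_assoc, h2,
    two_mul, add_smul]
  abel

/-- The Householder reflection sending `v` to `w`. -/
theorem exists_symm_orthogonal_mulVec_eq {ι : Type*} [Fintype ι] [DecidableEq ι] {v w : ι → ℝ}
    (h : v ⬝ᵥ v = w ⬝ᵥ w) : ∃ Q : Matrix ι ι ℝ, Qᵀ = Q ∧ Q * Q = 1 ∧ Q *ᵥ v = w := by
  refine ⟨1 - (2 / ((v - w) ⬝ᵥ (v - w))) • vecMulVec (v - w) (v - w), ?_,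
    householder_mul_self _, ?_⟩
  · simp [transpose_sub, transpose_smul]
  · have h1 : (v - w) ⬝ᵥ (v - w) = 2 * ((v - w) ⬝ᵥ v) := by
      simp only [sub_dotProduct, dotProduct_sub, dotProduct_comm w v]
      linarith
    rw [sub_mulVec, one_mulVec, smul_mulVec, vecMulVec_mulVec]
    rcases eq_or_ne ((v - w) ⬝ᵥ (v - w)) 0 with h0 | h0
    · have : v - w = 0 := dotProduct_self_eq_zero.1 h0
      rw [sub_eq_zero] at this
      simp [this]
    · ext i
      have h2 : 2 / ((v - w) ⬝ᵥ (v - w)) * ((v - w) ⬝ᵥ v) = 1 := by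
        rw [div_mul_eq_mul_div, ← h1, div_self h0]
      have h3 : (v i - w i) * (2 / ((v - w) ⬝ᵥ (v - w)) * ((v - w) ⬝ᵥ v)) = v i - w i := by
        rw [h2, mul_one]
      simp only [Pi.sub_apply, Pi.smul_apply, smul_eq_mul, op_smul_eq_smul]
      linarith

open scoped MatrixOrder in
/-- A square root `M` of `Ω` along which `α` becomes a multiple of a coordinate vector. -/
theorem exists_canonical_factor {ι : Type*} [Fintype ι] [DecidableEq ι] {Ω : Matrix ι ι ℝ}
    (hΩ : Ω.PosDef) (α : ι → ℝ) (i₀ : ι) :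
    ∃ M : Matrix ι ι ℝ, M * Mᵀ = Ω ∧ Mᵀ *ᵥ α = Pi.single i₀ (Real.sqrt (α ⬝ᵥ (Ω *ᵥ α))) := by
  obtain ⟨B, hB⟩ := CStarAlgebra.nonneg_iff_eq_star_mul_self.mp hΩ.posSemidef.nonneg
  have hB' : Ω = Bᵀ * B := by simpa [star_eq_conjTranspose] using hB
  have hnn : 0 ≤ α ⬝ᵥ (Ω *ᵥ α) := by
    simpa using hΩ.posSemidef.dotProduct_mulVec_nonneg α
  obtain ⟨Q, hQt, hQQ, hQ⟩ := exists_symm_orthogonal_mulVec_eq (v := B *ᵥ α)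
    (w := Pi.single i₀ (Real.sqrt (α ⬝ᵥ (Ω *ᵥ α)))) (by
      rw [dotProduct_single, Pi.single_eq_same, Real.mul_self_sqrt hnn, hB', ← mulVec_mulVec,
        dotProduct_mulVec α, vecMul_transpose])
  refine ⟨Bᵀ * Q, ?_, ?_⟩
  · rw [transpose_mul, transpose_transpose, hQt, Matrix.mul_assoc, ← Matrix.mul_assoc Q, hQQ,
      Matrix.one_mul, hB']
  · rw [transpose_mul, transpose_transpose, hQt, ← mulVec_mulVec, hQ]

theorem prod_stdNormalPDF {d : ℕ} (x : Fin d → ℝ) :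
    ∏ i, stdNormalPDF (x i) = (2 * Real.pi) ^ (-(d : ℝ) / 2) * Real.exp (-(x ⬝ᵥ x) / 2) := by
  have h : ∀ i, stdNormalPDF (x i)
      = (2 * Real.pi) ^ (-(1 : ℝ) / 2) * Real.exp (-(x i * x i) / 2) := fun i => by
    rw [stdNormalPDF, Real.sqrt_eq_rpow, ← Real.rpow_neg (by positivity), sq]
    norm_num
  simp only [h, Finset.prod_mul_distrib, Finset.prod_const, Finset.card_univ, Fintype.card_fin,
    ← Real.exp_sum]
  rw [← Real.rpow_natCast, ← Real.rpow_mul (by positivity), dotProduct, ← Finset.sum_div,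
    Finset.sum_neg_distrib]
  congr 2
  ring

theorem mvnPDF_mulVec {d : ℕ} {M Ωb : Matrix (Fin d) (Fin d) ℝ} (hM : M.det ≠ 0)
    (hMM : M * Mᵀ = Ωb) (x : Fin d → ℝ) :
    |M.det| * mvnPDF Ωb (M *ᵥ x) = ∏ i, stdNormalPDF (x i) := by
  have hu : IsUnit M.det := hM.isUnit
  have hdet : Ωb.det ^ (-(1 : ℝ) / 2) = |M.det|⁻¹ := by
    rw [← hMM, det_mul, det_transpose, neg_div, Real.rpow_neg (mul_self_nonneg _),
      ← Real.sqrt_eq_rpow, Real.sqrt_mul_self_eq_abs]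
  have hquad : (M *ᵥ x) ⬝ᵥ (Ωb⁻¹ *ᵥ (M *ᵥ x)) = x ⬝ᵥ x := by
    rw [← hMM, Matrix.mul_inv_rev, mulVec_mulVec, Matrix.mul_assoc, nonsing_inv_mul _ hu, Matrix.mul_one,
      ← transpose_nonsing_inv, mulVec_transpose, dotProduct_comm, ← dotProduct_mulVec,
      mulVec_mulVec, nonsing_inv_mul _ hu, one_mulVec]
  rw [mvnPDF, hdet, hquad, prod_stdNormalPDF]
  have : |M.det| ≠ 0 := abs_ne_zero.2 hM
  field_simp

/-- Marginal densities of the canonical form: skew-normal in the coordinate `i₀`, normal in the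
others. -/
def canonicalPDF {d : ℕ} (a : ℝ) (i₀ i : Fin d) (x : ℝ) : ℝ :=
  if i = i₀ then sn1PDF a x else stdNormalPDF x

theorem withDensity_canonicalPDF {d : ℕ} (a : ℝ) (i₀ i : Fin d) :
    (volume.withDensity fun x => ENNReal.ofReal (canonicalPDF a i₀ i x))
      = if i = i₀ then sn1Law a else gaussianReal 0 1 := by
  unfold canonicalPDF
  split_ifs
  · rfl
  · exact gaussianReal_eq_withDensity_stdNormalPDF.symm

theorem continuous_snPDF {d : ℕ} (ξ : Fin d → ℝ) (Ωm : Matrix (Fin d) (Fin d) ℝ) (α : Fin d → ℝ) :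
    Continuous (snPDF ξ Ωm α) := by
  have h : Continuous fun z : Fin d → ℝ => α ⬝ᵥ ((scaleMat Ωm)⁻¹ *ᵥ (z - ξ)) := by fun_prop
  have h2 : Continuous fun z : Fin d → ℝ => mvnPDF Ωm (z - ξ) := by
    unfold mvnPDF; fun_prop
  exact (h2.const_mul 2).mul (continuous_stdNormalCDF.comp h)

theorem IsSN.map_canonical {Ω' : Type*} [MeasurableSpace Ω'] {P : Measure Ω'} {d : ℕ}
    {Z : Ω' → Fin d → ℝ} {Ωb M : Matrix (Fin d) (Fin d) ℝ} {α : Fin d → ℝ} {a : ℝ} {i₀ : Fin d}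
    (hZ : IsSN P Z 0 Ωb α) (hZmeas : Measurable Z) (hcorr : ∀ i, Ωb i i = 1) (hM : M.det ≠ 0)
    (hMM : M * Mᵀ = Ωb) (hMα : Mᵀ *ᵥ α = Pi.single i₀ a) :
    Measure.map (fun t => M⁻¹ *ᵥ Z t) P
      = Measure.pi fun i => if i = i₀ then sn1Law a else gaussianReal 0 1 := by
  have hsc : scaleMat Ωb = 1 := by simp [scaleMat, hcorr]
  have hdens : ∀ x : Fin d → ℝ,
      |M.det| * snPDF 0 Ωb α (M *ᵥ x) = ∏ i, canonicalPDF a i₀ i (x i) := fun x => by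
    have h1 : ∀ i, canonicalPDF a i₀ i (x i)
        = stdNormalPDF (x i) * if i = i₀ then 2 * stdNormalCDF (a * x i) else 1 := fun i => by
      unfold canonicalPDF sn1PDF
      split_ifs <;> ring
    have h2 : α ⬝ᵥ (M *ᵥ x) = a * x i₀ := by
      rw [dotProduct_mulVec, ← mulVec_transpose, hMα, single_dotProduct]
    simp only [h1, Finset.prod_mul_distrib, Finset.prod_ite_eq', Finset.mem_univ, if_true]
    rw [snPDF, sub_zero, hsc, inv_one, one_mulVec, h2, ← mvnPDF_mulVec hM hMM]
    ring
  have hjoint : Measure.map Z P = Measure.map (fun x => M *ᵥ x)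
      (Measure.pi fun i => if i = i₀ then sn1Law a else gaussianReal 0 1) := by
    simp only [← withDensity_canonicalPDF]
    rw [pi_withDensity_ofReal (ρ := canonicalPDF a i₀), hZ,
      ← map_mulVec_withDensity hM (continuous_snPDF 0 Ωb α).measurable.ennreal_ofReal]
    · simp only [← ENNReal.ofReal_mul (abs_nonneg _), hdens]
    · intro i x
      unfold canonicalPDF
      split_ifs
      exacts [sn1PDF_nonneg a x, (stdNormalPDF_pos x).le]
    · intro i
      unfold canonicalPDF
      split_ifs
      exacts [integrable_sn1PDF a, integrable_stdNormalPDF]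
  have hmeas : ∀ A : Matrix (Fin d) (Fin d) ℝ, Measurable fun x : Fin d → ℝ => A *ᵥ x := fun A =>
    (Continuous.matrix_mulVec continuous_const continuous_id).measurable
  have h : Measure.map (fun t => M⁻¹ *ᵥ Z t) P
      = Measure.map (fun x => M⁻¹ *ᵥ x) (Measure.map Z P) :=
    (Measure.map_map (hmeas _) hZmeas).symm
  rw [h, hjoint, Measure.map_map (hmeas _) (hmeas _)]
  simp [Function.comp_def, nonsing_inv_mul _ hM.isUnit]

theorem integral_sq_gaussianReal : ∫ x, x ^ 2 ∂gaussianReal 0 1 = 1 := by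
  rw [integral_gaussianReal_eq_integral_smul one_ne_zero, ← stdNormalPDF_eq_gaussianPDFReal,
    ← integral_sq_mul_stdNormalPDF]
  simp [mul_comm]

theorem integral_cube_gaussianReal : ∫ x, x ^ 3 ∂gaussianReal 0 1 = 0 := by
  rw [integral_gaussianReal_eq_integral_smul one_ne_zero, ← stdNormalPDF_eq_gaussianPDFReal,
    ← integral_pow_mul_stdNormalPDF_of_odd (n := 3) (by decide)]
  simp [mul_comm]

theorem integral_sq_sn1Law (a : ℝ) : ∫ x, x ^ 2 ∂sn1Law a = 1 := by
  rw [integral_sn1Law, integral_mul_sn1PDF_of_even a even_two, integral_sq_mul_stdNormalPDF]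

section CanonicalMoments

variable {Ω' : Type*} [MeasurableSpace Ω'] {P : Measure Ω'} {d : ℕ}
  {X : Ω' → Fin d → ℝ} {a : ℝ} {i₀ : Fin d}

theorem map_eval_canonical (hX : Measurable X)
    (hlaw : Measure.map X P = Measure.pi fun i => if i = i₀ then sn1Law a else gaussianReal 0 1)
    (i : Fin d) :
    Measure.map (fun t => X t i) P = if i = i₀ then sn1Law a else gaussianReal 0 1 := by
  have hp : ∀ i, IsProbabilityMeasure (if i = i₀ then sn1Law a else gaussianReal 0 1) := fun i => by
    split_ifs <;> infer_instance
  have h := (measurePreserving_eval (fun i => if i = i₀ then sn1Law a else gaussianReal 0 1) i).map_eq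
  rw [← h, ← hlaw, Measure.map_map (measurable_pi_apply i) hX]
  rfl

theorem memLp_canonical (hX : Measurable X)
    (hlaw : Measure.map X P = Measure.pi fun i => if i = i₀ then sn1Law a else gaussianReal 0 1)
    (i : Fin d) : MemLp (fun t => X t i) 3 P := by
  have h : MemLp (fun x => x) 3 (Measure.map (fun t => X t i) P) := by
    rw [map_eval_canonical hX hlaw]
    split_ifs
    exacts [memLp_three_sn1Law a, memLp_id_gaussianReal 3]
  exact h.comp_of_map ((measurable_pi_apply i).comp hX).aemeasurable

theorem integral_pow_canonical (hX : Measurable X)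
    (hlaw : Measure.map X P = Measure.pi fun i => if i = i₀ then sn1Law a else gaussianReal 0 1)
    (i : Fin d) (n : ℕ) :
    ∫ t, X t i ^ n ∂P
      = if i = i₀ then ∫ x, x ^ n ∂sn1Law a else ∫ x, x ^ n ∂gaussianReal 0 1 := by
  have hXi : Measurable fun t => X t i := (measurable_pi_apply i).comp hX
  rw [← integral_map (f := fun x : ℝ => x ^ n) hXi.aemeasurable (by fun_prop),
    map_eval_canonical hX hlaw]
  split_ifs <;> rfl

theorem integral_canonical (hX : Measurable X)
    (hlaw : Measure.map X P = Measure.pi fun i => if i = i₀ then sn1Law a else gaussianReal 0 1)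
    (i : Fin d) :
    ∫ t, X t i ∂P = (∫ x, x ∂sn1Law a) * if i = i₀ then 1 else 0 := by
  have h := integral_pow_canonical hX hlaw i 1
  simp only [pow_one, integral_id_gaussianReal] at h
  rw [h]
  split_ifs <;> simp

variable [IsProbabilityMeasure P]

theorem iIndepFun_canonical (hX : Measurable X)
    (hlaw : Measure.map X P = Measure.pi fun i => if i = i₀ then sn1Law a else gaussianReal 0 1) :
    iIndepFun (fun i t => X t i) P := by
  have hXm : ∀ i, AEMeasurable (fun t => X t i) P := fun i =>
    ((measurable_pi_apply i).comp hX).aemeasurable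
  rw [iIndepFun_iff_map_fun_eq_pi_map hXm]
  simp only [map_eval_canonical hX hlaw]
  exact hlaw

theorem integral_mul_canonical (hX : Measurable X)
    (hlaw : Measure.map X P = Measure.pi fun i => if i = i₀ then sn1Law a else gaussianReal 0 1)
    (i j : Fin d) : ∫ t, X t i * X t j ∂P = if i = j then 1 else 0 := by
  have hXm : ∀ i, Measurable fun t => X t i := fun i => (measurable_pi_apply i).comp hX
  by_cases hij : i = j
  · subst hij
    simp only [← sq]
    rw [integral_pow_canonical hX hlaw i 2, integral_sq_sn1Law, integral_sq_gaussianReal]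
    simp
  · rw [((iIndepFun_canonical hX hlaw).indepFun hij).integral_fun_mul_eq_mul_integral
      (hXm i).aestronglyMeasurable (hXm j).aestronglyMeasurable, integral_canonical hX hlaw,
      integral_canonical hX hlaw, if_neg hij]
    by_cases hi : i = i₀
    · rw [if_neg fun hj : j = i₀ => hij (hi.trans hj.symm)]; ring
    · rw [if_neg hi]; ring

theorem integral_mul_mul_canonical (hX : Measurable X)
    (hlaw : Measure.map X P = Measure.pi fun i => if i = i₀ then sn1Law a else gaussianReal 0 1)
    (i j k : Fin d) :
    ∫ t, X t i * X t j * X t k ∂P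
      = (∫ x, x ∂sn1Law a) * ((if i = i₀ then 1 else 0) * (if j = k then 1 else 0)
          + (if j = i₀ then 1 else 0) * (if i = k then 1 else 0)
          + (if k = i₀ then 1 else 0) * (if i = j then 1 else 0))
        + (∫ x, x ^ 3 ∂sn1Law a - 3 * ∫ x, x ∂sn1Law a)
          * ((if i = i₀ then 1 else 0) * (if j = i₀ then 1 else 0) * (if k = i₀ then 1 else 0)) := by
  have hXm : ∀ i, Measurable fun t => X t i := fun i => (measurable_pi_apply i).comp hX
  have hfac : ∀ i j k, i ≠ k → j ≠ k → ∫ t, X t i * X t j * X t k ∂P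
      = (if i = j then 1 else 0) * ((∫ x, x ∂sn1Law a) * if k = i₀ then 1 else 0) :=
    fun i j k hik hjk => by
      rw [← integral_mul_canonical hX hlaw i j, ← integral_canonical hX hlaw k]
      exact ((iIndepFun_canonical hX hlaw).indepFun_mul_left hXm i j k hik
        hjk).integral_fun_mul_eq_mul_integral ((hXm i).mul (hXm j)).aestronglyMeasurable
        (hXm k).aestronglyMeasurable
  by_cases hik : i = k
  · subst hik
    by_cases hji : j = i
    · subst hji
      have h3 : ∀ t, X t j * X t j * X t j = X t j ^ 3 := fun t => by ring
      simp only [h3]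
      rw [integral_pow_canonical hX hlaw j 3, integral_cube_gaussianReal]
      split_ifs <;> simp
      ring
    · have h3 : ∀ t, X t i * X t j * X t i = X t i * X t i * X t j := fun t => by ring
      simp only [h3]
      rw [hfac i i j (Ne.symm hji) (Ne.symm hji)]
      split_ifs <;> simp_all
  · by_cases hjk : j = k
    · subst hjk
      have h3 : ∀ t, X t i * X t j * X t j = X t j * X t j * X t i := fun t => by ring
      simp only [h3]
      rw [hfac j j i (Ne.symm hik) (Ne.symm hik)]
      split_ifs <;> simp_all
    · rw [hfac i j k hik hjk]
      split_ifs <;> simp_all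

end CanonicalMoments

/-- `f` is integrable with expectation `c`. -/
def HasMean {Ω' : Type*} [MeasurableSpace Ω'] (P : Measure Ω') (f : Ω' → ℝ) (c : ℝ) : Prop :=
  Integrable f P ∧ ∫ t, f t ∂P = c

namespace HasMean

variable {Ω' : Type*} [MeasurableSpace Ω'] {P : Measure Ω'} {f g : Ω' → ℝ} {a b : ℝ}

theorem const [IsProbabilityMeasure P] (c : ℝ) : HasMean P (fun _ => c) c :=
  ⟨integrable_const c, by simp⟩

theorem add (hf : HasMean P f a) (hg : HasMean P g b) : HasMean P (fun t => f t + g t) (a + b) :=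
  ⟨hf.1.add hg.1, by rw [integral_add hf.1 hg.1, hf.2, hg.2]⟩

theorem sub (hf : HasMean P f a) (hg : HasMean P g b) : HasMean P (fun t => f t - g t) (a - b) :=
  ⟨hf.1.sub hg.1, by rw [integral_sub hf.1 hg.1, hf.2, hg.2]⟩

theorem const_mul (c : ℝ) (hf : HasMean P f a) : HasMean P (fun t => c * f t) (c * a) :=
  ⟨hf.1.const_mul c, by rw [integral_const_mul, hf.2]⟩

theorem sum {ι : Type*} [Fintype ι] {F : ι → Ω' → ℝ} {c : ι → ℝ} (h : ∀ i, HasMean P (F i) (c i)) :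
    HasMean P (fun t => ∑ i, F i t) (∑ i, c i) :=
  ⟨integrable_finsetSum _ fun i _ => (h i).1, by
    rw [integral_finsetSum _ fun i _ => (h i).1]; exact Finset.sum_congr rfl fun i _ => (h i).2⟩

theorem congr (hf : HasMean P f a) (h : ∀ t, g t = f t) (hab : b = a) : HasMean P g b := by
  rwa [funext h, hab]

end HasMean

section Mixture

variable {Ω' : Type*} [MeasurableSpace Ω'] {P : Measure Ω'} {ι : Type*}
  {S : Ω' → ℝ} {X : Ω' → ι → ℝ}

theorem hasMean_pow_mul (hSX : IndepFun S X P) (n : ℕ) {f : (ι → ℝ) → ℝ} (hf : Measurable f)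
    (hS : Integrable (fun t => S t ^ n) P) (hfX : Integrable (fun t => f (X t)) P) :
    HasMean P (fun t => S t ^ n * f (X t)) ((∫ t, S t ^ n ∂P) * ∫ t, f (X t) ∂P) := by
  have h : IndepFun (fun t => S t ^ n) (fun t => f (X t)) P :=
    hSX.comp (measurable_id.pow_const n) hf
  exact ⟨h.integrable_mul hS hfX,
    h.integral_fun_mul_eq_mul_integral hS.aestronglyMeasurable hfX.aestronglyMeasurable⟩

theorem integrable_mul_mul_of_memLp_three {f g h : Ω' → ℝ} (hf : MemLp f 3 P) (hg : MemLp g 3 P)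
    (hh : MemLp h 3 P) : Integrable (fun t => f t * g t * h t) P := by
  have h3 : (∑ _i : Fin 3, (3 : ENNReal)⁻¹)⁻¹ = 1 := by
    simp [ENNReal.mul_inv_cancel]
  have := MemLp.prod' (μ := P) (s := Finset.univ) (f := ![f, g, h]) (p := fun _ => 3)
    (by intro i _; fin_cases i <;> assumption)
  rw [h3] at this
  simpa [Fin.prod_univ_three] using memLp_one_iff_integrable.1 this

theorem memLp_three_of_integrable_cube (hS : Measurable S) (h : Integrable (fun t => S t ^ 3) P) :
    MemLp S 3 P := by
  refine (integrable_norm_rpow_iff hS.aestronglyMeasurable (by simp) (by simp)).1 ?_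
  refine h.norm.congr (ae_of_all _ fun t => ?_)
  norm_num

variable [IsProbabilityMeasure P]

/-- Moments of the centered mixture `S X` in terms of those of `S` and `X`. -/
theorem hasMean_mixture (hSX : IndepFun S X P) (hS : MemLp S 3 P)
    (hX : ∀ i, MemLp (fun t => X t i) 3 P) (i j k : ι) :
    let m := fun i => (∫ t, S t ∂P) * ∫ t, X t i ∂P
    HasMean P (fun t => S t * X t i) (m i) ∧
    HasMean P (fun t => (S t * X t i - m i) * (S t * X t j - m j))
      ((∫ t, S t ^ 2 ∂P) * (∫ t, X t i * X t j ∂P) - m i * m j) ∧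
    HasMean P (fun t => (S t * X t i - m i) * (S t * X t j - m j) * (S t * X t k - m k))
      ((∫ t, S t ^ 3 ∂P) * (∫ t, X t i * X t j * X t k ∂P)
        - (∫ t, S t ^ 2 ∂P) * (m i * (∫ t, X t j * X t k ∂P) + m j * (∫ t, X t i * X t k ∂P)
            + m k * (∫ t, X t i * X t j ∂P)) + 2 * (m i * m j * m k)) := by
  intro m
  have hle : ∀ {f : Ω' → ℝ}, MemLp f 3 P → MemLp f 2 P := fun hf =>
    hf.mono_exponent (by norm_num)
  have hle1 : ∀ {f : Ω' → ℝ}, MemLp f 3 P → Integrable f P := fun hf =>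
    hf.integrable (by norm_num)
  have hS2 : Integrable (fun t => S t ^ 2) P := (hle hS).integrable_sq
  have hS3 : Integrable (fun t => S t ^ 3) P :=
    (integrable_mul_mul_of_memLp_three hS hS hS).congr (ae_of_all _ fun t => by ring)
  have H1 : ∀ i, HasMean P (fun t => S t * X t i) (m i) := fun i => by
    simpa [m] using hasMean_pow_mul hSX 1 (f := fun x => x i) (by fun_prop)
      (by simpa using hle1 hS) (hle1 (hX i))
  have H2 : ∀ i j, HasMean P (fun t => S t ^ 2 * (X t i * X t j)) _ := fun i j =>
    hasMean_pow_mul hSX 2 (f := fun x => x i * x j) (by fun_prop) hS2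
      ((hle (hX i)).integrable_mul (hle (hX j)))
  have H3 := hasMean_pow_mul hSX 3 (f := fun x => x i * x j * x k) (by fun_prop) hS3
    (integrable_mul_mul_of_memLp_three (hX i) (hX j) (hX k))
  refine ⟨H1 i, ?_, ?_⟩
  · exact ((((H2 i j).sub ((H1 i).const_mul (m j))).sub ((H1 j).const_mul (m i))).add
      (.const (m i * m j))).congr (fun t => by ring) (by ring)
  · exact ((((((((H3.sub ((H2 j k).const_mul (m i))).sub ((H2 i k).const_mul (m j))).sub
      ((H2 i j).const_mul (m k))).add ((H1 i).const_mul (m j * m k))).add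
      ((H1 j).const_mul (m i * m k))).add ((H1 k).const_mul (m i * m j))).sub
      (.const (m i * m j * m k)))).congr (fun t => by ring) (by ring)

end Mixture

open scoped Kronecker in
theorem sum_contract_eq_kronecker {ι κ : Type*} [Fintype ι] [Fintype κ] (G : Matrix ι ι ℝ)
    (N : Matrix ι κ ℝ) (T : κ → κ → κ → ℝ) :
    (∑ i, ∑ j, ∑ k, ∑ i', ∑ j', ∑ k', G i i' * G j j' * G k k'
        * (∑ a, ∑ b, ∑ c, N i a * N j b * N k c * T a b c)
        * (∑ a, ∑ b, ∑ c, N i' a * N j' b * N k' c * T a b c))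
      = (fun p : κ × κ × κ => T p.1 p.2.1 p.2.2) ⬝ᵥ
          (((Nᵀ * G * N) ⊗ₖ ((Nᵀ * G * N) ⊗ₖ (Nᵀ * G * N))) *ᵥ
            fun p : κ × κ × κ => T p.1 p.2.1 p.2.2) := by
  set τ : κ × κ × κ → ℝ := fun p => T p.1 p.2.1 p.2.2 with hτ
  have hN : ∀ i j k, ∑ a, ∑ b, ∑ c, N i a * N j b * N k c * T a b c
      = ((N ⊗ₖ (N ⊗ₖ N)) *ᵥ τ) (i, j, k) := fun i j k => by
    simp only [mulVec, dotProduct, Fintype.sum_prod_type, kroneckerMap_apply, hτ]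
    exact Finset.sum_congr rfl fun a _ => Finset.sum_congr rfl fun b _ =>
      Finset.sum_congr rfl fun c _ => by ring
  have hK : (Nᵀ * G * N) ⊗ₖ ((Nᵀ * G * N) ⊗ₖ (Nᵀ * G * N))
      = (N ⊗ₖ (N ⊗ₖ N))ᵀ * (G ⊗ₖ (G ⊗ₖ G)) * (N ⊗ₖ (N ⊗ₖ N)) := by
    simp only [mul_kronecker_mul, kroneckerMap_transpose]
  rw [hK, Matrix.mul_assoc, ← mulVec_mulVec, dotProduct_mulVec, vecMul_transpose, ← mulVec_mulVec]
  simp only [hN]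
  generalize (N ⊗ₖ (N ⊗ₖ N)) *ᵥ τ = y
  simp only [mulVec, dotProduct, Fintype.sum_prod_type, kroneckerMap_apply, Finset.mul_sum]
  exact Finset.sum_congr rfl fun i _ => Finset.sum_congr rfl fun j _ =>
    Finset.sum_congr rfl fun k _ => Finset.sum_congr rfl fun i' _ => Finset.sum_congr rfl fun j' _ =>
    Finset.sum_congr rfl fun k' _ => by ring

/-- Contraction of a tensor by the inverse of `N D Nᵀ`, in coordinates where `D` is diagonal. -/
theorem sum_contract_inv {ι : Type*} [Fintype ι] [DecidableEq ι] {N : Matrix ι ι ℝ} {D : ι → ℝ}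
    (hN : N.det ≠ 0) (hD : ∀ i, D i ≠ 0) (T : ι → ι → ι → ℝ) :
    (∑ i, ∑ j, ∑ k, ∑ i', ∑ j', ∑ k',
        (N * diagonal D * Nᵀ)⁻¹ i i' * (N * diagonal D * Nᵀ)⁻¹ j j' * (N * diagonal D * Nᵀ)⁻¹ k k'
        * (∑ a, ∑ b, ∑ c, N i a * N j b * N k c * T a b c)
        * (∑ a, ∑ b, ∑ c, N i' a * N j' b * N k' c * T a b c))
      = ∑ a, ∑ b, ∑ c, (D a)⁻¹ * (D b)⁻¹ * (D c)⁻¹ * T a b c ^ 2 := by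
  have hdiag : (diagonal D)⁻¹ = diagonal fun i => (D i)⁻¹ :=
    inv_eq_right_inv (by simp [diagonal_mul_diagonal, hD])
  have hNt : IsUnit Nᵀ.det := by rw [det_transpose]; exact hN.isUnit
  have hG : Nᵀ * (N * diagonal D * Nᵀ)⁻¹ * N = diagonal fun i => (D i)⁻¹ := by
    rw [Matrix.mul_inv_rev, Matrix.mul_inv_rev, ← Matrix.mul_assoc, mul_nonsing_inv _ hNt,
      Matrix.one_mul, Matrix.mul_assoc, nonsing_inv_mul _ hN.isUnit, Matrix.mul_one, hdiag]
  rw [sum_contract_eq_kronecker, hG]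
  simp only [diagonal_kronecker_diagonal, mulVec_diagonal, dotProduct, Fintype.sum_prod_type]
  exact Finset.sum_congr rfl fun a _ => Finset.sum_congr rfl fun b _ =>
    Finset.sum_congr rfl fun c _ => by ring

theorem sum_canonical_tensor_sq (n : ℕ) (u v A B : ℝ) :
    (∑ a : Fin (n + 1), ∑ b : Fin (n + 1), ∑ c : Fin (n + 1),
        (if a = 0 then u else v)⁻¹ * (if b = 0 then u else v)⁻¹ * (if c = 0 then u else v)⁻¹
        * (A * ((if a = 0 then 1 else 0) * (if b = c then 1 else 0)
              + (if b = 0 then 1 else 0) * (if a = c then 1 else 0)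
              + (if c = 0 then 1 else 0) * (if a = b then 1 else 0))
            + B * ((if a = 0 then 1 else 0) * (if b = 0 then 1 else 0)
              * (if c = 0 then 1 else 0))) ^ 2)
      = (3 * A + B) ^ 2 / u ^ 3 + 3 * n * A ^ 2 / (u * v ^ 2) := by
  simp only [Fin.sum_univ_succ, Fin.succ_ne_zero, (Fin.succ_ne_zero _).symm, if_true, if_false,
    Fin.succ_inj, mul_zero, zero_mul, add_zero, zero_add, mul_one, one_mul]
  simp [ite_pow]
  ring

theorem dotProduct_deltaOf {d : ℕ} {Ωb : Matrix (Fin d) (Fin d) ℝ} (hΩ : Ωb.PosDef)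
    (α : Fin d → ℝ) :
    deltaOf Ωb α ⬝ᵥ (Ωb⁻¹ *ᵥ deltaOf Ωb α) = α ⬝ᵥ (Ωb *ᵥ α) / (1 + α ⬝ᵥ (Ωb *ᵥ α)) := by
  have hnn : 0 ≤ α ⬝ᵥ (Ωb *ᵥ α) := by simpa using hΩ.posSemidef.dotProduct_mulVec_nonneg α
  rw [deltaOf, mulVec_smul, mulVec_mulVec, nonsing_inv_mul _ hΩ.det_pos.ne'.isUnit, one_mulVec,
    smul_dotProduct, dotProduct_smul, smul_smul, ← mul_inv, Real.mul_self_sqrt (by positivity),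
    dotProduct_comm, smul_eq_mul, div_eq_inv_mul]

theorem integral_sn1Law_sq (a : ℝ) :
    (∫ x, x ∂sn1Law a) ^ 2 = 2 / Real.pi * (a ^ 2 / (1 + a ^ 2)) := by
  rw [integral_sn1Law, integral_mul_sn1PDF, mul_pow, div_pow,
    Real.sq_sqrt (by have := Real.pi_pos; positivity), Real.sq_sqrt (by positivity)]

theorem integral_sn1Law_sq_lt_one (a : ℝ) : (∫ x, x ∂sn1Law a) ^ 2 < 1 := by
  rw [integral_sn1Law_sq]
  have h1 : 2 / Real.pi < 1 := by
    rw [div_lt_one Real.pi_pos]; linarith [Real.pi_gt_three]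
  have h2 : a ^ 2 / (1 + a ^ 2) ≤ 1 := by
    rw [div_le_one (by positivity)]; linarith
  have h3 : 0 < 2 / Real.pi := div_pos two_pos Real.pi_pos
  nlinarith

theorem integral_cube_sn1Law_zero : ∫ x, x ^ 3 ∂sn1Law 0 = 0 := by
  have h0 : stdNormalCDF 0 = 1 / 2 := by
    have := stdNormalCDF_add_neg 0
    rw [neg_zero] at this
    linarith
  rw [integral_sn1Law]
  refine Eq.trans ?_ (integral_pow_mul_stdNormalPDF_of_odd (n := 3) (by decide))
  congr 1 with x
  rw [sn1PDF, zero_mul, h0]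
  ring

section

variable {Ω' : Type*} [MeasurableSpace Ω'] {P : Measure Ω'} [IsProbabilityMeasure P]
  {S : Ω' → ℝ}

/-- Central moments of the scalar mixture `S W` with `W ~ SN₁(0, 1, a)`. -/
theorem integral_mixture_sn1Law {W : Ω' → ℝ} {a : ℝ} (hWmeas : Measurable W)
    (hW : Measure.map W P = sn1Law a) (hSW : IndepFun S W P) (hS : MemLp S 3 P) :
    let β := ∫ x, x ∂sn1Law a
    let m := ∫ t, S t * W t ∂P
    ∫ t, (S t * W t - m) ^ 2 ∂P = (∫ t, S t ^ 2 ∂P) - (∫ t, S t ∂P) ^ 2 * β ^ 2 ∧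
    ∫ t, (S t * W t - m) ^ 3 ∂P = (∫ t, S t ^ 3 ∂P) * (∫ x, x ^ 3 ∂sn1Law a)
        - 3 * (∫ t, S t ^ 2 ∂P) * (∫ t, S t ∂P) * β + 2 * (∫ t, S t ∂P) ^ 3 * β ^ 3 := by
  intro β m
  have hind : IndepFun S (fun t (_ : Unit) => W t) P :=
    hSW.comp measurable_id (measurable_pi_lambda (fun w (_ : Unit) => w) fun _ => measurable_id)
  have hmom : ∀ n : ℕ, ∫ t, W t ^ n ∂P = ∫ x, x ^ n ∂sn1Law a := fun n => by
    rw [← hW, integral_map hWmeas.aemeasurable (by fun_prop)]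
  have hmem : MemLp W 3 P :=
    (hW ▸ memLp_three_sn1Law a : MemLp (fun x => x) 3 (Measure.map W P)).comp_of_map
      hWmeas.aemeasurable
  have h1 : ∫ t, W t ∂P = β := by simpa using hmom 1
  have h2 : ∫ t, W t * W t ∂P = 1 := by
    simpa [← sq] using (hmom 2).trans (integral_sq_sn1Law a)
  have h3 : ∫ t, W t * W t * W t ∂P = ∫ x, x ^ 3 ∂sn1Law a := by
    rw [← hmom 3]; congr 1 with t; ring
  obtain ⟨H1, H2, H3⟩ := hasMean_mixture hind hS (fun _ => hmem) () () ()
  simp only [h1, h2, h3] at H1 H2 H3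
  have hm : m = (∫ t, S t ∂P) * β := H1.2
  rw [hm]
  constructor
  · exact (H2.congr (fun t => by ring) (by ring)).2
  · exact (H3.congr (fun t => by ring) (by ring)).2

theorem integral_sq_pos_of_pos (hS : MemLp S 3 P) (hSpos : ∀ᵐ t ∂P, 0 < S t) :
    0 < ∫ t, S t ^ 2 ∂P := by
  have hi : Integrable (fun t => S t ^ 2) P := (hS.mono_exponent (by norm_num)).integrable_sq
  refine lt_of_le_of_ne (integral_nonneg fun t => sq_nonneg _) fun h => ?_
  have h0 := (integral_eq_zero_iff_of_nonneg (fun t => sq_nonneg (S t)) hi).1 h.symm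
  obtain ⟨t, ht, ht'⟩ := (hSpos.and h0).exists
  exact (pow_pos ht 2).ne' ht'

theorem sq_integral_le_integral_sq (hS : MemLp S 3 P) :
    (∫ t, S t ∂P) ^ 2 ≤ ∫ t, S t ^ 2 ∂P := by
  have h := variance_nonneg S P
  rw [variance_eq_sub (hS.mono_exponent (by norm_num))] at h
  simpa using h

end


/-- Mardia's multivariate skewness index of a scale mixture of
skew-normal distributions `Y = ξ + ω S Z`. -/
theorem mardia_skewness_scale_mixture
    {Ω' : Type*} [MeasurableSpace Ω'] (P : MeasureTheory.Measure Ω')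
    [MeasureTheory.IsProbabilityMeasure P]
    {d : ℕ} (α ξ : Fin d → ℝ) (Ωb : Matrix (Fin d) (Fin d) ℝ)
    (hΩ : Ωb.PosDef) (hcorr : ∀ i, Ωb i i = 1)
    (ωv : Fin d → ℝ) (hωv : ∀ i, 0 < ωv i)
    (Z : Ω' → Fin d → ℝ) (hZmeas : Measurable Z) (hZ : IsSN P Z 0 Ωb α)
    (S : Ω' → ℝ) (hSmeas : Measurable S) (hSpos : ∀ᵐ t ∂P, 0 < S t)
    (hindep : ProbabilityTheory.IndepFun S Z P)
    (hS3 : Integrable (fun t => S t ^ 3) P)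
    -- `W ~ SN₁(0,1,α*)` independent of `S`, so that `Y₁* = S W` is the skewed
    -- component of the canonical form
    (W : Ω' → ℝ) (hWmeas : Measurable W)
    (hW : Measure.map W P = volume.withDensity fun x =>
      ENNReal.ofReal (sn1PDF (Real.sqrt (α ⬝ᵥ (Ωb *ᵥ α))) x))
    (hSW : ProbabilityTheory.IndepFun S W P) :
    let δ := deltaOf Ωb α
    let δstar := Real.sqrt (δ ⬝ᵥ (Ωb⁻¹ *ᵥ δ))
    let ES := ∫ t, S t ∂P
    let ES2 := ∫ t, S t ^ 2 ∂P
    let ES3 := ∫ t, S t ^ 3 ∂P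
    let σstar2 := ES2 - (2 / Real.pi) * ES ^ 2 * δstar ^ 2
    let Y := fun t => ξ + S t • (Matrix.diagonal ωv *ᵥ Z t)
    let μ := fun i => ∫ t, Y t i ∂P
    let Sig : Matrix (Fin d) (Fin d) ℝ :=
      Matrix.of fun i j => ∫ t, (Y t i - μ i) * (Y t j - μ j) ∂P
    let μ3 := fun i j k => ∫ t, (Y t i - μ i) * (Y t j - μ j) * (Y t k - μ k) ∂P
    let Y1 := fun t => S t * W t
    let mY1 := ∫ t, Y1 t ∂P
    let γ1star := (∫ t, (Y1 t - mY1) ^ 3 ∂P) / Real.sqrt (∫ t, (Y1 t - mY1) ^ 2 ∂P) ^ 3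
    -- Mardia's skewness index γ_{1,d} of Y
    (∑ i, ∑ j, ∑ k, ∑ i', ∑ j', ∑ k',
        Sig⁻¹ i i' * Sig⁻¹ j j' * Sig⁻¹ k k' * μ3 i j k * μ3 i' j' k')
      = γ1star ^ 2 +
          3 * ((d : ℝ) - 1) / (σstar2 * ES2 ^ 2) * (ES3 - ES * ES2) ^ 2 *
            (2 / Real.pi) * δstar ^ 2 := by
  intro δ δstar ES ES2 ES3 σstar2 Y μ Sig μ3 Y1 mY1 γ1star
  set a := Real.sqrt (α ⬝ᵥ (Ωb *ᵥ α)) with ha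
  set β := ∫ x, x ∂sn1Law a with hβ
  have hnn : 0 ≤ α ⬝ᵥ (Ωb *ᵥ α) := by simpa using hΩ.posSemidef.dotProduct_mulVec_nonneg α
  have hS := memLp_three_of_integrable_cube hSmeas hS3
  have hES2 : 0 < ES2 := integral_sq_pos_of_pos hS hSpos
  have hβδ : 2 / Real.pi * δstar ^ 2 = β ^ 2 := by
    rw [integral_sn1Law_sq, ha, Real.sq_sqrt hnn]
    simp only [δstar, δ]
    rw [dotProduct_deltaOf hΩ, Real.sq_sqrt (by positivity)]
  have hσ : σstar2 = ES2 - ES ^ 2 * β ^ 2 := by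
    simp only [σstar2]
    rw [← hβδ]
    ring
  have hσpos : 0 < σstar2 := by
    have h1 : ES ^ 2 ≤ ES2 := sq_integral_le_integral_sq hS
    have h2 := integral_sn1Law_sq_lt_one a
    rw [← hβ] at h2
    rw [hσ]
    nlinarith [sq_nonneg β]
  obtain ⟨hY2, hY3⟩ := integral_mixture_sn1Law hWmeas hW hSW hS
  change ∫ t, (Y1 t - mY1) ^ 2 ∂P = ES2 - ES ^ 2 * β ^ 2 at hY2
  change ∫ t, (Y1 t - mY1) ^ 3 ∂P
    = ES3 * (∫ x, x ^ 3 ∂sn1Law a) - 3 * ES2 * ES * β + 2 * ES ^ 3 * β ^ 3 at hY3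
  have hγ : γ1star ^ 2
      = (ES3 * (∫ x, x ^ 3 ∂sn1Law a) - 3 * ES2 * ES * β + 2 * ES ^ 3 * β ^ 3) ^ 2
        / σstar2 ^ 3 := by
    simp only [γ1star]
    rw [hY3, hY2, ← hσ, div_pow, ← pow_mul, mul_comm 3 2, pow_mul, Real.sq_sqrt hσpos.le]
  rw [mul_assoc _ (2 / Real.pi), hβδ, hγ]
  rcases d with _ | n
  · have ha0 : a = 0 := by simp [ha]
    have hβ0 : β = 0 := by
      have h := integral_sn1Law_sq a
      rw [← hβ, ha0] at h
      simpa using h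
    simp [hβ0, ha0, integral_cube_sn1Law_zero]
  obtain ⟨M, hMM, hMα⟩ := exists_canonical_factor hΩ α 0
  rw [← ha] at hMα
  have hMdet : M.det ≠ 0 := fun h => by
    have := hΩ.det_pos
    rw [← hMM, det_mul, h, zero_mul] at this
    exact lt_irrefl _ this
  set X : Ω' → Fin (n + 1) → ℝ := fun t => M⁻¹ *ᵥ Z t with hXdef
  have hXlinear : Measurable fun x : Fin (n + 1) → ℝ => M⁻¹ *ᵥ x :=
    (Continuous.matrix_mulVec continuous_const continuous_id).measurable
  have hX : Measurable X := hXlinear.comp hZmeas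
  have hlaw := hZ.map_canonical hZmeas hcorr hMdet hMM hMα
  have hSX : IndepFun S X P := hindep.comp measurable_id hXlinear
  set N : Matrix (Fin (n + 1)) (Fin (n + 1)) ℝ := diagonal ωv * M with hN
  have hNdet : N.det ≠ 0 := by
    rw [hN, det_mul, det_diagonal]
    exact mul_ne_zero (Finset.prod_ne_zero_iff.2 fun i _ => (hωv i).ne') hMdet
  have hY : ∀ t i, Y t i = ξ i + ∑ b, N i b * (S t * X t b) := fun t i => by
    have h1 : diagonal ωv *ᵥ Z t = N *ᵥ X t := by
      rw [hN, hXdef, mulVec_mulVec, Matrix.mul_assoc, mul_nonsing_inv _ hMdet.isUnit, Matrix.mul_one]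
    simp only [Y, h1, Pi.add_apply, Pi.smul_apply, smul_eq_mul, mulVec, dotProduct, Finset.mul_sum]
    congr 1
    exact Finset.sum_congr rfl fun b _ => by ring
  have hmix := hasMean_mixture hSX hS (memLp_canonical hX hlaw)
  simp only [integral_canonical hX hlaw, integral_mul_canonical hX hlaw,
    integral_mul_mul_canonical hX hlaw] at hmix
  have e1 : ∫ t, S t ∂P = ES := rfl
  have e2 : ∫ t, S t ^ 2 ∂P = ES2 := rfl
  have e3 : ∫ t, S t ^ 3 ∂P = ES3 := rfl
  simp only [← hβ, e1, e2, e3] at hmix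
  set m : Fin (n + 1) → ℝ := fun b => ES * (β * if b = 0 then 1 else 0) with hm
  have hμ : ∀ i, μ i = ξ i + ∑ b, N i b * m b := fun i => by
    refine (((HasMean.const (ξ i)).add (HasMean.sum fun b =>
      ((hmix b b b).1).const_mul (N i b))).congr (fun t => hY t i) rfl).2
  have hcent : ∀ t i, Y t i - μ i = ∑ b, N i b * (S t * X t b - m b) := fun t i => by
    rw [hY, hμ]
    simp only [mul_sub, Finset.sum_sub_distrib]
    ring
  have hSig : Sig = N * diagonal (fun i => if i = 0 then σstar2 else ES2) * Nᵀ := by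
    ext i j
    have h := HasMean.sum fun b => HasMean.sum fun c =>
      ((hmix b c c).2.1).const_mul (N i b * N j c)
    refine (h.congr (fun t => ?_) ?_).2
    · simp only [hcent, Finset.sum_mul_sum]
      exact Finset.sum_congr rfl fun b _ => Finset.sum_congr rfl fun c _ => by ring
    · have hR : (N * diagonal (fun i => if i = 0 then σstar2 else ES2) * Nᵀ : Matrix _ _ ℝ) i j
          = ∑ b, ∑ c, N i b * N j c * diagonal (fun i => if i = 0 then σstar2 else ES2) b c := by
        simp only [mul_apply, Finset.sum_mul, transpose_apply]
        rw [Finset.sum_comm]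
        exact Finset.sum_congr rfl fun b _ => Finset.sum_congr rfl fun c _ => by ring
      rw [hR]
      refine Finset.sum_congr rfl fun b _ => Finset.sum_congr rfl fun c _ => ?_
      rw [diagonal_apply, hσ]
      by_cases hbc : b = c
      · subst hbc
        by_cases hb : b = 0 <;> simp only [hb, if_true, if_false] <;> ring
      · by_cases hb : b = 0
        · have hc : c ≠ 0 := fun h => hbc (hb.trans h.symm)
          simp [hbc, hc]
        · simp [hbc, hb]
  set T : Fin (n + 1) → Fin (n + 1) → Fin (n + 1) → ℝ := fun p q r =>
    (β * (ES3 - ES * ES2)) * ((if p = 0 then 1 else 0) * (if q = r then 1 else 0)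
              + (if q = 0 then 1 else 0) * (if p = r then 1 else 0)
              + (if r = 0 then 1 else 0) * (if p = q then 1 else 0))
            + (ES3 * ((∫ x, x ^ 3 ∂sn1Law a) - 3 * β) + 2 * ES ^ 3 * β ^ 3)
              * ((if p = 0 then 1 else 0) * (if q = 0 then 1 else 0)
              * (if r = 0 then 1 else 0)) with hT
  have hμ3 : ∀ i j k, μ3 i j k = ∑ b, ∑ c, ∑ e, N i b * N j c * N k e * T b c e := fun i j k => by
    have h := HasMean.sum fun b => HasMean.sum fun c => HasMean.sum fun e =>
      ((hmix b c e).2.2).const_mul (N i b * N j c * N k e)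
    refine (h.congr (fun t => ?_) ?_).2
    · rw [hcent, hcent, hcent, Finset.sum_mul_sum, Finset.sum_mul]
      refine Finset.sum_congr rfl fun b _ => ?_
      rw [Finset.sum_mul_sum]
      exact Finset.sum_congr rfl fun c _ => Finset.sum_congr rfl fun e _ => by
        simp only [hm]
        ring
    · refine Finset.sum_congr rfl fun b _ => Finset.sum_congr rfl fun c _ =>
        Finset.sum_congr rfl fun e _ => ?_
      simp only [hT]
      ring
  have hD : ∀ i : Fin (n + 1), (if i = 0 then σstar2 else ES2) ≠ 0 := fun i => by
    split_ifs
    exacts [hσpos.ne', hES2.ne']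
  simp only [hμ3, hSig]
  rw [sum_contract_inv hNdet hD T]
  simp only [hT]
  rw [sum_canonical_tensor_sq]
  push_cast
  field_simp
  ring

end
end
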